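/- If W is a subcategory of A with W ⊥ W, then the Gorenstein subcategory G(W) is closed under direct summands: if A' and A'' are objects of A such that A' ⊕ A'' lies in G(W), then both A' and A'' lie in G(W). -/

import Mathlib

open CategoryTheory CategoryTheory.Limits CategoryTheory.Abelian

universe w v u

variable {C : Type u} [Category.{v} C] [Abelian C]

/-- A class of objects is closed under isomorphisms. -/
def IsoClosed (𝒲 : Set C) : Prop :=
  ∀ ⦃A B : C⦄, (A ≅ B) → A ∈ 𝒲 → B ∈ 𝒲

/-- A class of objects is closed under finite direct sums (part of being an
additive subcategory). -/
def SumClosed (𝒲 : Set C) : Prop :=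
  ∀ ⦃A B : C⦄, A ∈ 𝒲 → B ∈ 𝒲 → (A ⊞ B) ∈ 𝒲

/-- A class of objects is closed under extensions. -/
def ExtensionClosed (𝒲 : Set C) : Prop :=
  ∀ ⦃A₁ A₂ A₃ : C⦄ (f : A₁ ⟶ A₂) (g : A₂ ⟶ A₃) (w : f ≫ g = 0),
    (ShortComplex.mk f g w).ShortExact → A₁ ∈ 𝒲 → A₃ ∈ 𝒲 → A₂ ∈ 𝒲

/-- A class of objects is closed under kernels of epimorphisms. -/
def KerEpiClosed (𝒲 : Set C) : Prop :=
  ∀ ⦃A₁ A₂ A₃ : C⦄ (f : A₁ ⟶ A₂) (g : A₂ ⟶ A₃) (w : f ≫ g = 0),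
    (ShortComplex.mk f g w).ShortExact → A₂ ∈ 𝒲 → A₃ ∈ 𝒲 → A₁ ∈ 𝒲

/-- A class of objects is closed under cokernels of monomorphisms. -/
def CokerMonoClosed (𝒲 : Set C) : Prop :=
  ∀ ⦃A₁ A₂ A₃ : C⦄ (f : A₁ ⟶ A₂) (g : A₂ ⟶ A₃) (w : f ≫ g = 0),
    (ShortComplex.mk f g w).ShortExact → A₁ ∈ 𝒲 → A₂ ∈ 𝒲 → A₃ ∈ 𝒲

section ExtDefs

variable [HasExt.{w} C]

/-- `X ⊥ Y`, i.e. `Ext^i(X, Y) = 0` for all `i ≥ 1`. -/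
def extPerp (X Y : C) : Prop :=
  ∀ i : ℕ, 1 ≤ i → Subsingleton (Abelian.Ext X Y i)

end ExtDefs

/-- `𝒲` is a cogenerator for `𝒳`: `𝒲 ⊆ 𝒳` and every object of `𝒳` embeds in an
object of `𝒲` with cokernel in `𝒳`. -/
def IsCogen (𝒲 𝒳 : Set C) : Prop :=
  𝒲 ⊆ 𝒳 ∧ ∀ X ∈ 𝒳, ∃ (W X' : C) (i : X ⟶ W) (p : W ⟶ X') (w : i ≫ p = 0),
    W ∈ 𝒲 ∧ X' ∈ 𝒳 ∧ (ShortComplex.mk i p w).ShortExact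

/-- `𝒱` is a generator for `𝒴`: `𝒱 ⊆ 𝒴` and every object of `𝒴` is a quotient of an
object of `𝒱` with kernel in `𝒴`. -/
def IsGen (𝒱 𝒴 : Set C) : Prop :=
  𝒱 ⊆ 𝒴 ∧ ∀ Y ∈ 𝒴, ∃ (Y' V : C) (i : Y' ⟶ V) (p : V ⟶ Y) (w : i ≫ p = 0),
    V ∈ 𝒱 ∧ Y' ∈ 𝒴 ∧ (ShortComplex.mk i p w).ShortExact

section ExtDefs2

variable [HasExt.{w} C]

/-- `𝒲` is an injective cogenerator for `𝒳`. -/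
def IsInjCogen (𝒲 𝒳 : Set C) : Prop :=
  IsCogen 𝒲 𝒳 ∧ ∀ X ∈ 𝒳, ∀ W ∈ 𝒲, extPerp X W

/-- `𝒱` is a projective generator for `𝒴`. -/
def IsProjGen (𝒱 𝒴 : Set C) : Prop :=
  IsGen 𝒱 𝒴 ∧ ∀ V ∈ 𝒱, ∀ Y ∈ 𝒴, extPerp V Y

end ExtDefs2

/-- The data `(P, d, ε)` is a resolution of `M`: the augmented complex
`⋯ → P₁ → P₀ → M → 0` is exact. -/
structure IsResolution (P : ℕ → C) (d : ∀ n, P (n + 1) ⟶ P n) (M : C) (ε : P 0 ⟶ M) :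
    Prop where
  w0 : d 0 ≫ ε = 0
  w : ∀ n, d (n + 1) ≫ d n = 0
  epi : Epi ε
  exact0 : (ShortComplex.mk (d 0) ε w0).Exact
  exact : ∀ n, (ShortComplex.mk (d (n + 1)) (d n) (w n)).Exact

/-- The data `(Q, δ, η)` is a coresolution of `M`: the augmented complex
`0 → M → Q⁰ → Q¹ → ⋯` is exact. -/
structure IsCoresolution (Q : ℕ → C) (δ : ∀ n, Q n ⟶ Q (n + 1)) (M : C) (η : M ⟶ Q 0) :
    Prop where
  w0 : η ≫ δ 0 = 0
  w : ∀ n, δ n ≫ δ (n + 1) = 0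
  mono : Mono η
  exact0 : (ShortComplex.mk η (δ 0) w0).Exact
  exact : ∀ n, (ShortComplex.mk (δ n) (δ (n + 1)) (w n)).Exact

/-- `Hom(W', -)` applied to the augmented complex `⋯ → P₁ → P₀ → M → 0` is exact for
every `W'` in `𝒳` (properness of the resolution). -/
def ResHomExact (𝒳 : Set C) (P : ℕ → C) (d : ∀ n, P (n + 1) ⟶ P n) {M : C}
    (ε : P 0 ⟶ M) : Prop :=
  ∀ W ∈ 𝒳,
    (∀ φ : W ⟶ M, ∃ ψ : W ⟶ P 0, ψ ≫ ε = φ) ∧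
    (∀ φ : W ⟶ P 0, φ ≫ ε = 0 → ∃ ψ : W ⟶ P 1, ψ ≫ d 0 = φ) ∧
    (∀ (n : ℕ) (φ : W ⟶ P (n + 1)), φ ≫ d n = 0 → ∃ ψ : W ⟶ P (n + 2), ψ ≫ d (n + 1) = φ)

/-- `Hom(-, W')` applied to the augmented complex `0 → M → Q⁰ → Q¹ → ⋯` is exact for
every `W'` in `𝒲` (properness of the coresolution). -/
def CoresHomExact (𝒲 : Set C) (Q : ℕ → C) (δ : ∀ n, Q n ⟶ Q (n + 1)) {M : C}
    (η : M ⟶ Q 0) : Prop :=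
  ∀ W ∈ 𝒲,
    (∀ φ : M ⟶ W, ∃ ψ : Q 0 ⟶ W, η ≫ ψ = φ) ∧
    (∀ φ : Q 0 ⟶ W, η ≫ φ = 0 → ∃ ψ : Q 1 ⟶ W, δ 0 ≫ ψ = φ) ∧
    (∀ (n : ℕ) (φ : Q (n + 1) ⟶ W), δ n ≫ φ = 0 → ∃ ψ : Q (n + 2) ⟶ W, δ (n + 1) ≫ ψ = φ)

/-- `M` admits a proper `𝒳`-resolution, i.e. `M ∈ res~(𝒳)`. -/
def MemProperRes (𝒳 : Set C) (M : C) : Prop :=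
  ∃ (P : ℕ → C) (d : ∀ n, P (n + 1) ⟶ P n) (ε : P 0 ⟶ M),
    (∀ n, P n ∈ 𝒳) ∧ IsResolution P d M ε ∧ ResHomExact 𝒳 P d ε

/-- `M` admits a proper `𝒲`-coresolution, i.e. `M ∈ cores~(𝒲)`. -/
def MemProperCores (𝒲 : Set C) (M : C) : Prop :=
  ∃ (Q : ℕ → C) (δ : ∀ n, Q n ⟶ Q (n + 1)) (η : M ⟶ Q 0),
    (∀ n, Q n ∈ 𝒲) ∧ IsCoresolution Q δ M η ∧ CoresHomExact 𝒲 Q δ η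

/-- `M` has finite `𝒴`-projective dimension: it admits a resolution
`0 → Y_n → ⋯ → Y_0 → M → 0` with all `Y_i` in `𝒴`, i.e. `M ∈ res^f(𝒴)`. -/
def FinResDim (𝒴 : Set C) (M : C) : Prop :=
  ∃ (n : ℕ) (P : ℕ → C) (d : ∀ k, P (k + 1) ⟶ P k) (ε : P 0 ⟶ M),
    (∀ k ≤ n, P k ∈ 𝒴) ∧ (∀ k, n < k → IsZero (P k)) ∧ IsResolution P d M ε

/-- `M` has finite `𝒳`-injective dimension: it admits a coresolution
`0 → M → X^0 → ⋯ → X^n → 0` with all `X^i` in `𝒳`, i.e. `M ∈ cores^f(𝒳)`. -/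
def FinCoresDim (𝒳 : Set C) (M : C) : Prop :=
  ∃ (n : ℕ) (Q : ℕ → C) (δ : ∀ k, Q k ⟶ Q (k + 1)) (η : M ⟶ Q 0),
    (∀ k ≤ n, Q k ∈ 𝒳) ∧ (∀ k, n < k → IsZero (Q k)) ∧ IsCoresolution Q δ M η

/-- The `ℤ`-indexed complex `(X, d)` is totally `𝒳`-acyclic: all terms lie in `𝒳`,
it is exact, and `Hom(W, -)` and `Hom(-, W)` applied to it are exact for all `W ∈ 𝒳`. -/
structure IsTotallyAcyclic (𝒳 : Set C) (X : ℤ → C) (d : ∀ n : ℤ, X (n + 1) ⟶ X n) :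
    Prop where
  mem : ∀ n, X n ∈ 𝒳
  w : ∀ n, d (n + 1) ≫ d n = 0
  exact : ∀ n, (ShortComplex.mk (d (n + 1)) (d n) (w n)).Exact
  homExact : ∀ W ∈ 𝒳, ∀ (n : ℤ) (φ : W ⟶ X (n + 1)), φ ≫ d n = 0 →
    ∃ ψ : W ⟶ X (n + 1 + 1), ψ ≫ d (n + 1) = φ
  homExact' : ∀ W ∈ 𝒳, ∀ (n : ℤ) (φ : X (n + 1) ⟶ W), d (n + 1) ≫ φ = 0 →
    ∃ ψ : X n ⟶ W, d n ≫ ψ = φ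

/-- The Gorenstein subcategory `G(𝒳)`: objects isomorphic to `Coker(∂₁)` of a totally
`𝒳`-acyclic complex. -/
def GorClass (𝒳 : Set C) : Set C :=
  {M | ∃ (X : ℤ → C) (d : ∀ n : ℤ, X (n + 1) ⟶ X n),
    IsTotallyAcyclic 𝒳 X d ∧ Nonempty (cokernel (d 0) ≅ M)}

/-- Iterated Gorenstein subcategories: `G^0(𝒳) = 𝒳`, `G^{n+1}(𝒳) = G(G^n(𝒳))`. -/
def GorIter (𝒳 : Set C) : ℕ → Set C
  | 0 => 𝒳
  | n + 1 => GorClass (GorIter 𝒳 n)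

/-- The upper triangular matrix morphism `[[a, b], [0, c]]` between biproducts. -/
noncomputable def triMat {P' P'' Q' Q'' : C} (a : P' ⟶ Q') (b : P'' ⟶ Q') (c : P'' ⟶ Q'') :
    P' ⊞ P'' ⟶ Q' ⊞ Q'' :=
  biprod.lift (biprod.fst ≫ a + biprod.snd ≫ b) (biprod.snd ≫ c)

namespace GorAux

/-- Short exactness, unbundled. -/
def SES {A B D : C} (f : A ⟶ B) (g : B ⟶ D) : Prop :=
  ∃ w : f ≫ g = 0, (ShortComplex.mk f g w).ShortExact

section basic
variable {A B D : C} {f : A ⟶ B} {g : B ⟶ D}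

lemma SES.w (h : SES f g) : f ≫ g = 0 := h.1
lemma SES.mono (h : SES f g) : Mono f := h.2.mono_f
lemma SES.epi (h : SES f g) : Epi g := h.2.epi_g
lemma SES.lift (h : SES f g) {Z : C} (z : Z ⟶ B) (hz : z ≫ g = 0) : ∃ x, x ≫ f = z := by
  have := h.2.mono_f
  exact ⟨h.2.exact.lift z hz, h.2.exact.lift_f z hz⟩
lemma SES.desc (h : SES f g) {Z : C} (z : B ⟶ Z) (hz : f ≫ z = 0) : ∃ x, g ≫ x = z := by
  have := h.2.epi_g
  exact ⟨h.2.exact.desc z hz, h.2.exact.g_desc z hz⟩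

lemma SES.of_lift (w : f ≫ g = 0) (hf : Mono f) (hg : Epi g)
    (H : ∀ (Z : C) (z : Z ⟶ B), z ≫ g = 0 → ∃ x, x ≫ f = z) : SES f g := by
  refine ⟨w, ⟨?_⟩⟩
  rw [ShortComplex.exact_iff_exact_up_to_refinements]
  intro Z z hz
  obtain ⟨x, hx⟩ := H Z z hz
  exact ⟨Z, 𝟙 _, inferInstance, x, by simpa using hx.symm⟩

lemma SES.of_desc (w : f ≫ g = 0) (hf : Mono f) (hg : Epi g)
    (H : ∀ (Z : C) (z : B ⟶ Z), f ≫ z = 0 → ∃ x, g ≫ x = z) : SES f g := by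
  refine ⟨w, ⟨?_⟩⟩
  apply ShortComplex.exact_of_g_is_cokernel
  exact CokernelCofork.IsColimit.ofπ' _ _ (fun z hz => ⟨(H _ z hz).choose, (H _ z hz).choose_spec⟩)

lemma SES.kernel (g : B ⟶ D) [Epi g] : SES (kernel.ι g) g :=
  SES.of_lift (by simp) inferInstance inferInstance (fun _ z hz => ⟨kernel.lift g z hz, by simp⟩)

lemma SES.cokernel (f : A ⟶ B) [Mono f] : SES f (cokernel.π f) :=
  SES.of_desc (by simp) inferInstance inferInstance
    (fun _ z hz => ⟨cokernel.desc f z hz, by simp⟩)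

end basic

lemma horse_left {E₁ E E₂ W₁ W₂ E₁' E₂' : C} {f : E₁ ⟶ E} {g : E ⟶ E₂} (h : SES f g)
    {i₁ : E₁' ⟶ W₁} {p₁ : W₁ ⟶ E₁} (h₁ : SES i₁ p₁)
    {i₂ : E₂' ⟶ W₂} {p₂ : W₂ ⟶ E₂} (h₂ : SES i₂ p₂) (l : W₂ ⟶ E) (hl : l ≫ g = p₂) :
    ∃ (K : C) (i : K ⟶ W₁ ⊞ W₂) (p : W₁ ⊞ W₂ ⟶ E) (a : E₁' ⟶ K) (b : K ⟶ E₂'),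
      SES i p ∧ SES a b := by
  have := h.mono
  have := h.epi
  have := h₁.mono
  have := h₁.epi
  have := h₂.mono
  have := h₂.epi
  let q : W₁ ⊞ W₂ ⟶ E := biprod.desc (p₁ ≫ f) l
  have hqg : q ≫ g = biprod.snd ≫ p₂ := by
    ext <;> simp [q, h.w, hl]
  have hq : Epi q := by
    rw [epi_iff_surjective_up_to_refinements]
    intro Z e
    obtain ⟨Z', π, hπ, y, hy⟩ := surjective_up_to_refinements_of_epi p₂ (e ≫ g)
    obtain ⟨x, hx⟩ := h.lift (π ≫ e - y ≫ l) (by simp [hl, hy])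
    obtain ⟨Z'', π', hπ', x', hx'⟩ := surjective_up_to_refinements_of_epi p₁ x
    refine ⟨Z'', π' ≫ π, inferInstance, biprod.lift x' (π' ≫ y), ?_⟩
    simp only [q, biprod.lift_desc, ← Category.assoc, ← hx']
    simp [hx]
  obtain ⟨b, hb⟩ := h₂.lift (kernel.ι q ≫ biprod.snd)
    (by rw [Category.assoc, ← hqg]; simp)
  have ha0 : (i₁ ≫ biprod.inl) ≫ q = 0 := by simp [q, reassoc_of% h₁.w]
  let a : E₁' ⟶ Limits.kernel q := kernel.lift q (i₁ ≫ biprod.inl) ha0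
  have ha : a ≫ kernel.ι q = i₁ ≫ biprod.inl := by simp [a]
  refine ⟨_, kernel.ι q, q, a, b, SES.kernel q, SES.of_lift ?_ ?_ ?_ ?_⟩
  · rw [← cancel_mono i₂, Category.assoc, hb, reassoc_of% ha]; simp
  · have : Mono (a ≫ kernel.ι q) := by rw [ha]; infer_instance
    exact mono_of_mono a (kernel.ι q)
  · rw [epi_iff_surjective_up_to_refinements]
    intro Z z
    obtain ⟨e, he⟩ := h.lift (z ≫ i₂ ≫ l) (by simp [hl, h₂.w])
    obtain ⟨Z', π, hπ, x, hx⟩ := surjective_up_to_refinements_of_epi p₁ e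
    refine ⟨Z', π, hπ, kernel.lift q (biprod.lift (-x) (π ≫ z ≫ i₂)) ?_, ?_⟩
    · simp [q, biprod.lift_desc, ← he, reassoc_of% hx]
    · rw [← cancel_mono i₂]; simp [hb]
  · intro Z z hz
    have h1 : z ≫ kernel.ι q ≫ biprod.snd = 0 := by rw [← hb, reassoc_of% hz]; simp
    have h3 : z ≫ kernel.ι q = (z ≫ kernel.ι q ≫ biprod.fst) ≫ biprod.inl := by
      ext <;> simp [h1]
    have h2 : (z ≫ kernel.ι q ≫ biprod.fst) ≫ p₁ = 0 := by
      rw [← cancel_mono f]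
      have : (z ≫ kernel.ι q) ≫ q = 0 := by simp
      rw [h3] at this
      simpa [q] using this
    obtain ⟨x, hx⟩ := h₁.lift _ h2
    refine ⟨x, ?_⟩
    rw [← cancel_mono (kernel.ι q), Category.assoc, ha, reassoc_of% hx, h3]
    simp

lemma horse_right {E₁ E E₂ W₁ W₂ E₁' E₂' : C} {f : E₁ ⟶ E} {g : E ⟶ E₂} (h : SES f g)
    {j₁ : E₁ ⟶ W₁} {q₁ : W₁ ⟶ E₁'} (h₁ : SES j₁ q₁)
    {j₂ : E₂ ⟶ W₂} {q₂ : W₂ ⟶ E₂'} (h₂ : SES j₂ q₂) (l : E ⟶ W₁) (hl : f ≫ l = j₁) :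
    ∃ (K : C) (i : E ⟶ W₁ ⊞ W₂) (p : W₁ ⊞ W₂ ⟶ K) (a : E₁' ⟶ K) (b : K ⟶ E₂'),
      SES i p ∧ SES a b := by
  have := h.mono
  have := h.epi
  have := h₁.mono
  have := h₁.epi
  have := h₂.mono
  have := h₂.epi
  let q : E ⟶ W₁ ⊞ W₂ := biprod.lift l (g ≫ j₂)
  have hfq : f ≫ q = j₁ ≫ biprod.inl := by
    ext <;> simp [q, reassoc_of% h.w, hl]
  have key : ∀ (Z : C) (e : Z ⟶ E), e ≫ q ≫ biprod.snd = 0 → ∃ x, x ≫ f = e := by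
    intro Z e he
    apply h.lift
    rw [← cancel_mono j₂]
    simpa [q] using he
  have hq : Mono q := by
    apply Preadditive.mono_of_cancel_zero
    intro Z e he
    obtain ⟨x, rfl⟩ := key Z e (by rw [reassoc_of% he]; simp)
    have : (x ≫ j₁) = 0 := by
      rw [Category.assoc, hfq] at he
      rw [← cancel_mono (biprod.inl : W₁ ⟶ W₁ ⊞ W₂)]; simpa using he
    have hx : x = 0 := by rw [← cancel_mono j₁, this]; simp
    simp [hx]
  obtain ⟨a, ha⟩ := h₁.desc (biprod.inl ≫ cokernel.π q) (by
    rw [← Category.assoc, ← hfq]; simp)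
  have hb0 : q ≫ biprod.snd ≫ q₂ = 0 := by simp [q, h₂.w]
  let b : Limits.cokernel q ⟶ E₂' := cokernel.desc q (biprod.snd ≫ q₂) hb0
  have hb : cokernel.π q ≫ b = biprod.snd ≫ q₂ := by simp [b]
  refine ⟨_, q, cokernel.π q, a, b, SES.cokernel q, SES.of_desc ?_ ?_ ?_ ?_⟩
  · rw [← cancel_epi q₁, reassoc_of% ha, hb]; simp
  · apply Preadditive.mono_of_cancel_zero
    intro Z z hz
    obtain ⟨Z', π, hπ, w, hw⟩ := surjective_up_to_refinements_of_epi q₁ z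
    obtain ⟨e, he⟩ := (SES.cokernel q).lift (w ≫ biprod.inl) (by
      rw [Category.assoc, ← ha, ← reassoc_of% hw, hz]; simp)
    obtain ⟨x, rfl⟩ := key _ e (by rw [reassoc_of% he]; simp)
    rw [Category.assoc, hfq, ← Category.assoc, cancel_mono] at he
    rw [← cancel_epi π, hw, ← he, Category.assoc, h₁.w]; simp
  · have : Epi (cokernel.π q ≫ b) := by rw [hb]; infer_instance
    exact epi_of_epi (cokernel.π q) b
  · intro Z t ht
    have h1 : biprod.inl ≫ cokernel.π q ≫ t = 0 := by rw [← reassoc_of% ha, ht]; simp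
    have h3 : cokernel.π q ≫ t = biprod.snd ≫ (biprod.inr ≫ cokernel.π q ≫ t) := by
      ext <;> simp [h1]
    have h2 : j₂ ≫ (biprod.inr ≫ cokernel.π q ≫ t) = 0 := by
      rw [← cancel_epi g]
      have : q ≫ (cokernel.π q ≫ t) = 0 := by simp
      rw [h3] at this
      simpa [q] using this
    obtain ⟨x, hx⟩ := h₂.desc _ h2
    refine ⟨x, ?_⟩
    rw [← cancel_epi (cokernel.π q), reassoc_of% hb, hx, ← h3]

lemma summand_left {E' X K Y : C} {i : E' ⟶ X} {p : X ⟶ K ⊞ Y} (h : SES i p) :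
    ∃ (K' : C) (j : K' ⟶ X) (q : X ⟶ K) (a : E' ⟶ K' ⊞ K) (b : K' ⊞ K ⟶ K ⊞ Y),
      SES j q ∧ SES a b := by
  have := h.mono
  have := h.epi
  let q : X ⟶ K := p ≫ biprod.fst
  let c : E' ⟶ kernel q := kernel.lift q i (by simp [q, reassoc_of% h.w])
  have hc : c ≫ kernel.ι q = i := by simp [c]
  have hq0 : kernel.ι q ≫ p ≫ biprod.fst = 0 := kernel.condition q
  refine ⟨_, kernel.ι q, q, biprod.lift c 0,
    biprod.lift biprod.snd (biprod.fst ≫ kernel.ι q ≫ p ≫ biprod.snd), SES.kernel q,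
    SES.of_lift ?_ ?_ ?_ ?_⟩
  · ext <;> simp [reassoc_of% hc, reassoc_of% h.w]
  · have : Mono (biprod.lift c (0 : E' ⟶ K) ≫ biprod.fst ≫ kernel.ι q) := by
      simp only [biprod.lift_fst_assoc, hc]; infer_instance
    exact mono_of_mono _ (biprod.fst ≫ kernel.ι q)
  · rw [epi_iff_surjective_up_to_refinements]
    intro Z z
    obtain ⟨Z', π, hπ, x, hx⟩ := surjective_up_to_refinements_of_epi p
      (biprod.lift 0 (z ≫ biprod.snd))
    have hx1 : x ≫ q = 0 := by simp [q, ← reassoc_of% hx]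
    refine ⟨Z', π, hπ, biprod.lift (kernel.lift q x hx1) (π ≫ z ≫ biprod.fst), ?_⟩
    ext
    · simp
    · simp [← reassoc_of% hx]
  · intro Z z hz
    have h1 : z ≫ biprod.snd = 0 := by simpa using hz =≫ biprod.fst
    have h2 : z ≫ biprod.fst ≫ kernel.ι q ≫ p ≫ biprod.snd = 0 := by
      simpa using hz =≫ biprod.snd
    obtain ⟨x, hx⟩ := h.lift (z ≫ biprod.fst ≫ kernel.ι q) (by
      ext
      · simp [hq0]
      · simp [h2])
    refine ⟨x, ?_⟩
    ext
    · simp [hc, hx]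
    · simp [h1]

lemma summand_right {E' X K Y : C} {i : K ⊞ Y ⟶ X} {p : X ⟶ E'} (h : SES i p) :
    ∃ (K' : C) (j : K ⟶ X) (q : X ⟶ K') (a : K ⊞ Y ⟶ K' ⊞ K) (b : K' ⊞ K ⟶ E'),
      SES j q ∧ SES a b := by
  have := h.mono
  have := h.epi
  let j : K ⟶ X := biprod.inl ≫ i
  let c : cokernel j ⟶ E' := cokernel.desc j p (by simp [j, h.w])
  have hc : cokernel.π j ≫ c = p := by simp [c]
  have hj0 : biprod.inl ≫ i ≫ cokernel.π j = 0 := by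
    rw [← Category.assoc]; exact cokernel.condition j
  refine ⟨_, j, cokernel.π j, biprod.lift (i ≫ cokernel.π j) biprod.fst,
    biprod.fst ≫ c, SES.cokernel j,
    SES.of_desc ?_ ?_ ?_ ?_⟩
  · simp [hc, h.w]
  · apply Preadditive.mono_of_cancel_zero
    intro Z z hz
    have h1 : z ≫ biprod.fst = 0 := by simpa using hz =≫ biprod.snd
    have h2 : z ≫ i ≫ cokernel.π j = 0 := by simpa using hz =≫ biprod.fst
    obtain ⟨t, ht⟩ := (SES.cokernel j).lift (z ≫ i) (by simpa using h2)
    have h3 : t ≫ biprod.inl = z := by rw [← cancel_mono i, ← ht]; simp [j]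
    have h4 : z ≫ biprod.snd = 0 := by rw [← h3]; simp
    ext <;> simp [h1, h4]
  · have : Epi (cokernel.π j ≫ c) := by rw [hc]; infer_instance
    have : Epi c := epi_of_epi (cokernel.π j) c
    infer_instance
  · intro Z t ht
    have e1 : biprod.inl ≫ biprod.lift (i ≫ cokernel.π j) (biprod.fst : K ⊞ Y ⟶ K) =
        biprod.inr := by
      ext <;> simp [hj0]
    have h1 : biprod.inr ≫ t = 0 := by rw [← e1, Category.assoc, ht]; simp
    have ht' : t = biprod.fst ≫ biprod.inl ≫ t := by ext <;> simp [h1]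
    have h2 : i ≫ (cokernel.π j ≫ biprod.inl ≫ t) = 0 := by
      rw [ht'] at ht
      simpa using ht
    obtain ⟨x, hx⟩ := h.desc _ h2
    refine ⟨x, ?_⟩
    have : c ≫ x = biprod.inl ≫ t := by
      rw [← cancel_epi (cokernel.π j), reassoc_of% hc, hx]
    rw [Category.assoc, this, ← ht']

section ext
variable [HasExt.{w} C]

lemma lift_of_ext {A B D W : C} {f : A ⟶ B} {g : B ⟶ D} (h : SES f g)
    (hE : Subsingleton (Ext W A 1)) (φ : W ⟶ D) : ∃ ψ, ψ ≫ g = φ := by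
  obtain ⟨x, hx⟩ := Ext.covariant_sequence_exact₃ W h.2 (Ext.mk₀ φ) (n₁ := 1) rfl
    (Subsingleton.elim _ _)
  obtain ⟨ψ, rfl⟩ := (Ext.mk₀_bijective _ _).2 x
  refine ⟨ψ, (Ext.mk₀_bijective _ _).1 ?_⟩
  simpa using hx

lemma desc_of_ext {A B D W : C} {f : A ⟶ B} {g : B ⟶ D} (h : SES f g)
    (hE : Subsingleton (Ext D W 1)) (φ : A ⟶ W) : ∃ ψ, f ≫ ψ = φ := by
  obtain ⟨x, hx⟩ := Ext.contravariant_sequence_exact₁ h.2 W (Ext.mk₀ φ) (n₁ := 1) rfl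
    (Subsingleton.elim _ _)
  obtain ⟨ψ, rfl⟩ := (Ext.mk₀_bijective _ _).2 x
  refine ⟨ψ, (Ext.mk₀_bijective _ _).1 ?_⟩
  simpa using hx

/-- Two-sided Ext¹-orthogonality to `𝒲`. -/
def Perp (𝒲 : Set C) (S : C) : Prop :=
  ∀ W ∈ 𝒲, Subsingleton (Ext W S 1) ∧ Subsingleton (Ext S W 1)

lemma Perp.ext {𝒲 : Set C} {A B D : C} {f : A ⟶ B} {g : B ⟶ D} (h : SES f g)
    (hA : Perp 𝒲 A) (hD : Perp 𝒲 D) : Perp 𝒲 B := by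
  intro W hW
  obtain ⟨a1, a2⟩ := hA W hW
  obtain ⟨d1, d2⟩ := hD W hW
  constructor
  · refine subsingleton_of_forall_eq 0 fun x => ?_
    obtain ⟨y, rfl⟩ := Ext.covariant_sequence_exact₂ W h.2 x (Subsingleton.elim (α := Ext W D 1) _ _)
    rw [show y = 0 from Subsingleton.elim (α := Ext W A 1) _ _]; simp
  · refine subsingleton_of_forall_eq 0 fun x => ?_
    obtain ⟨y, rfl⟩ := Ext.contravariant_sequence_exact₂ h.2 W x (Subsingleton.elim (α := Ext A W 1) _ _)
    rw [show y = 0 from Subsingleton.elim (α := Ext D W 1) _ _]; simp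

lemma Perp.retract {𝒲 : Set C} {A B : C} (s : A ⟶ B) (r : B ⟶ A) (h : s ≫ r = 𝟙 A)
    (hB : Perp 𝒲 B) : Perp 𝒲 A := by
  intro W hW
  obtain ⟨a1, a2⟩ := hB W hW
  constructor
  · refine subsingleton_of_forall_eq 0 fun x => ?_
    have : (x.comp (Ext.mk₀ s) (add_zero 1)).comp (Ext.mk₀ r) (add_zero 1) = x := by
      simp [h]
    rw [← this, show x.comp (Ext.mk₀ s) (add_zero 1) = 0 from Subsingleton.elim _ _]; simp
  · refine subsingleton_of_forall_eq 0 fun x => ?_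
    have : (Ext.mk₀ s).comp ((Ext.mk₀ r).comp x (zero_add 1)) (zero_add 1) = x := by
      simp [h]
    rw [← this, show (Ext.mk₀ r).comp x (zero_add 1) = 0 from Subsingleton.elim _ _]; simp

lemma ext_left_zero {A B D W : C} {f : A ⟶ B} {g : B ⟶ D} (h : SES f g)
    (hB : Subsingleton (Ext W B 1)) (H : ∀ φ : W ⟶ D, ∃ ψ, ψ ≫ g = φ) :
    Subsingleton (Ext W A 1) := by
  refine subsingleton_of_forall_eq 0 fun x => ?_
  obtain ⟨y, rfl⟩ := Ext.covariant_sequence_exact₁ W h.2 x (Subsingleton.elim (α := Ext W B 1) _ _)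
    (n₀ := 0) rfl
  obtain ⟨φ, rfl⟩ := (Ext.mk₀_bijective _ _).2 y
  obtain ⟨ψ, rfl⟩ := H φ
  rw [← Ext.mk₀_comp_mk₀, Ext.comp_assoc_of_second_deg_zero, h.2.comp_extClass]
  simp

lemma ext_right_zero {A B D W : C} {f : A ⟶ B} {g : B ⟶ D} (h : SES f g)
    (hB : Subsingleton (Ext B W 1)) (H : ∀ φ : A ⟶ W, ∃ ψ, f ≫ ψ = φ) :
    Subsingleton (Ext D W 1) := by
  refine subsingleton_of_forall_eq 0 fun x => ?_
  obtain ⟨y, rfl⟩ := Ext.contravariant_sequence_exact₃ h.2 W x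
    (Subsingleton.elim (α := Ext B W 1) _ _) (n₀ := 0) rfl
  obtain ⟨φ, rfl⟩ := (Ext.mk₀_bijective _ _).2 y
  obtain ⟨ψ, rfl⟩ := H φ
  rw [← Ext.mk₀_comp_mk₀]
  exact h.2.extClass_comp_assoc _

end ext

/-- `S'` is a syzygy of `S` with respect to `𝒲`. -/
def Syz (𝒲 : Set C) (S' S : C) : Prop :=
  ∃ (X : C) (i : S' ⟶ X) (p : X ⟶ S), X ∈ 𝒲 ∧ SES i p

/-- Gluing steps to a `ℤ`-indexed sequence. -/
lemma exists_seq {α : Type*} (R : α → α → Prop) (hl : ∀ a, ∃ b, R b a) (hr : ∀ a, ∃ b, R a b)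
    (a : α) : ∃ s : ℤ → α, s 0 = a ∧ ∀ n, R (s (n + 1)) (s n) := by
  choose L hL using hl
  choose Q hQ using hr
  let s : ℤ → α := fun n => match n with
    | Int.ofNat k => L^[k] a
    | Int.negSucc k => Q^[k + 1] a
  refine ⟨s, rfl, ?_⟩
  intro n
  match n with
  | Int.ofNat k =>
    have : s (Int.ofNat k + 1) = L (L^[k] a) := Function.iterate_succ_apply' L k a
    rw [this]
    exact hL _
  | Int.negSucc 0 => exact hQ a
  | Int.negSucc (k + 1) =>
    have : s (Int.negSucc (k + 1)) = Q (Q^[k + 1] a) := Function.iterate_succ_apply' Q (k + 1) a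
    rw [this]
    exact hQ _

lemma gor_of_class [HasExt.{w} C] (𝒲 𝒮 : Set C) (hp : ∀ S ∈ 𝒮, Perp 𝒲 S)
    (hl : ∀ S ∈ 𝒮, ∃ S' ∈ 𝒮, Syz 𝒲 S' S) (hr : ∀ S ∈ 𝒮, ∃ S' ∈ 𝒮, Syz 𝒲 S S')
    (M : C) (hM : M ∈ 𝒮) : M ∈ GorClass 𝒲 := by
  obtain ⟨s, hs0, hs⟩ := exists_seq (α := 𝒮) (fun a b => Syz 𝒲 a.1 b.1)
    (fun a => by obtain ⟨b, hb, h⟩ := hl a.1 a.2; exact ⟨⟨b, hb⟩, h⟩)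
    (fun a => by obtain ⟨b, hb, h⟩ := hr a.1 a.2; exact ⟨⟨b, hb⟩, h⟩) ⟨M, hM⟩
  choose X i p hX hses using hs
  have hi := fun n => (hses n).mono
  have hpe := fun n => (hses n).epi
  refine ⟨X, fun n => p (n + 1) ≫ i n, ?_, ?_⟩
  · have w : ∀ n, (p (n + 1 + 1) ≫ i (n + 1)) ≫ p (n + 1) ≫ i n = 0 := by
      intro n; simp [reassoc_of% (hses (n + 1)).w]
    refine ⟨hX, w, ?_, ?_, ?_⟩
    · intro n
      rw [ShortComplex.exact_iff_exact_up_to_refinements]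
      intro Z z hz
      obtain ⟨x, rfl⟩ := (hses (n + 1)).lift z (by
        rw [← cancel_mono (i n)]; simpa using hz)
      obtain ⟨Z', π, hπ, y, hy⟩ := surjective_up_to_refinements_of_epi (p (n + 1 + 1)) x
      exact ⟨Z', π, hπ, y, by simp [reassoc_of% hy]⟩
    · intro W hW n φ hφ
      obtain ⟨x, rfl⟩ := (hses (n + 1)).lift φ (by
        rw [← cancel_mono (i n)]; simpa using hφ)
      obtain ⟨y, rfl⟩ := lift_of_ext (hses (n + 1 + 1)) (hp _ (s _).2 W hW).1 x
      exact ⟨y, by simp⟩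
    · intro W hW n φ hφ
      obtain ⟨x, rfl⟩ := (hses (n + 1)).desc φ (by
        rw [← cancel_epi (p (n + 1 + 1))]; simpa using hφ)
      obtain ⟨y, rfl⟩ := desc_of_ext (hses n) (hp _ (s _).2 W hW).2 x
      exact ⟨y, by simp⟩
  · have e : (s 0).1 = M := by rw [hs0]
    have hc : IsColimit (CokernelCofork.ofπ (f := p (0 + 1) ≫ i 0) (p 0)
        (by simp [(hses 0).w])) := by
      refine CokernelCofork.IsColimit.ofπ' _ _ (fun z hz => ?_)
      have := (hses 0).desc z (by rw [← cancel_epi (p (0 + 1))]; simpa using hz)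
      exact ⟨this.choose, this.choose_spec⟩
    exact ⟨(cokernelIsCokernel _).coconePointUniqueUpToIso hc ≪≫ eqToIso e⟩

/-- Extension closure. -/
inductive ExtCl (𝒢 : Set C) : C → Prop
  | of (X : C) (h : X ∈ 𝒢) : ExtCl 𝒢 X
  | ext {A B D : C} (f : A ⟶ B) (g : B ⟶ D) (h : SES f g) (hA : ExtCl 𝒢 A) (hD : ExtCl 𝒢 D) :
      ExtCl 𝒢 B

section cl
variable [HasExt.{w} C] {𝒲 𝒢 : Set C}

lemma ExtCl.perp (hp : ∀ S ∈ 𝒢, Perp 𝒲 S) {E : C} (hE : ExtCl 𝒢 E) : Perp 𝒲 E := by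
  induction hE with
  | of X h => exact hp X h
  | ext f g h _ _ hA hD => exact Perp.ext h hA hD

lemma ExtCl.left (hsum : SumClosed 𝒲) (hp : ∀ S ∈ 𝒢, Perp 𝒲 S)
    (hl : ∀ S ∈ 𝒢, ∃ S' ∈ 𝒢, Syz 𝒲 S' S) {E : C} (hE : ExtCl 𝒢 E) :
    ∃ E', ExtCl 𝒢 E' ∧ Syz 𝒲 E' E := by
  induction hE with
  | of X h => obtain ⟨S, hS, h'⟩ := hl X h; exact ⟨S, .of _ hS, h'⟩
  | ext f g h hA hD ihA ihD =>
    obtain ⟨A', hA', W₁, i₁, p₁, hW₁, h₁⟩ := ihA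
    obtain ⟨D', hD', W₂, i₂, p₂, hW₂, h₂⟩ := ihD
    obtain ⟨l, hl⟩ := lift_of_ext h (hA.perp hp W₂ hW₂).1 p₂
    obtain ⟨K, i, p, a, b, hip, hab⟩ := horse_left h h₁ h₂ l hl
    exact ⟨K, .ext a b hab hA' hD', _, i, p, hsum hW₁ hW₂, hip⟩

lemma ExtCl.right (hsum : SumClosed 𝒲) (hp : ∀ S ∈ 𝒢, Perp 𝒲 S)
    (hr : ∀ S ∈ 𝒢, ∃ S' ∈ 𝒢, Syz 𝒲 S S') {E : C} (hE : ExtCl 𝒢 E) :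
    ∃ E', ExtCl 𝒢 E' ∧ Syz 𝒲 E E' := by
  induction hE with
  | of X h => obtain ⟨S, hS, h'⟩ := hr X h; exact ⟨S, .of _ hS, h'⟩
  | ext f g h hA hD ihA ihD =>
    obtain ⟨A', hA', W₁, i₁, p₁, hW₁, h₁⟩ := ihA
    obtain ⟨D', hD', W₂, i₂, p₂, hW₂, h₂⟩ := ihD
    obtain ⟨l, hl⟩ := desc_of_ext h (hD.perp hp W₁ hW₁).2 i₁
    obtain ⟨K, i, p, a, b, hip, hab⟩ := horse_right h h₁ h₂ l hl
    exact ⟨K, .ext a b hab hA' hD', _, i, p, hsum hW₁ hW₂, hip⟩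

lemma summand_gor (hsum : SumClosed 𝒲) (hp : ∀ S ∈ 𝒢, Perp 𝒲 S)
    (hl : ∀ S ∈ 𝒢, ∃ S' ∈ 𝒢, Syz 𝒲 S' S)
    (hr : ∀ S ∈ 𝒢, ∃ S' ∈ 𝒢, Syz 𝒲 S S') (K Y : C) (h : (K ⊞ Y) ∈ 𝒢) : K ∈ GorClass 𝒲 := by
  refine gor_of_class 𝒲 {K | ∃ Y, ExtCl 𝒢 (K ⊞ Y)} ?_ ?_ ?_ K ⟨Y, .of _ h⟩
  · rintro S ⟨Y, hY⟩
    exact Perp.retract biprod.inl biprod.fst (by simp) (hY.perp hp)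
  · rintro S ⟨Y, hY⟩
    obtain ⟨E', hE', X, i, p, hX, hip⟩ := hY.left hsum hp hl
    obtain ⟨K', j, q, a, b, hjq, hab⟩ := summand_left hip
    exact ⟨K', ⟨S, .ext a b hab hE' hY⟩, X, j, q, hX, hjq⟩
  · rintro S ⟨Y, hY⟩
    obtain ⟨E', hE', X, i, p, hX, hip⟩ := hY.right hsum hp hr
    obtain ⟨K', j, q, a, b, hjq, hab⟩ := summand_right hip
    exact ⟨K', ⟨S, .ext a b hab hY hE'⟩, X, j, q, hX, hjq⟩

end cl

section cyc
variable {𝒲 : Set C} {X : ℤ → C} {d : ∀ n : ℤ, X (n + 1) ⟶ X n}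

/-- The cokernels of the differentials. -/
def Cyc (X : ℤ → C) (d : ∀ n : ℤ, X (n + 1) ⟶ X n) : Set C :=
  {M | ∃ n, Nonempty (cokernel (d n) ≅ M)}

lemma exists_ses (h : IsTotallyAcyclic 𝒲 X d) (n : ℤ) :
    ∃ m : cokernel (d (n + 1)) ⟶ X n, cokernel.π (d (n + 1)) ≫ m = d n ∧
      SES m (cokernel.π (d n)) := by
  let m := cokernel.desc (d (n + 1)) (d n) (h.w n)
  have hm : cokernel.π (d (n + 1)) ≫ m = d n := by simp [m]
  refine ⟨m, hm, SES.of_desc ?_ ?_ inferInstance ?_⟩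
  · rw [← cancel_epi (cokernel.π (d (n + 1))), reassoc_of% hm]; simp
  · apply Preadditive.mono_of_cancel_zero
    intro Z z hz
    obtain ⟨Z', π, hπ, x, hx⟩ := surjective_up_to_refinements_of_epi (cokernel.π (d (n + 1))) z
    obtain ⟨Z'', π', hπ', y, hy⟩ := (h.exact n).exact_up_to_refinements x (by
      change x ≫ d n = 0
      rw [← hm, ← reassoc_of% hx, hz]; simp)
    change π' ≫ x = y ≫ d (n + 1) at hy
    rw [← cancel_epi π, ← cancel_epi π', hx, reassoc_of% hy]; simp
  · intro Z z hz
    exact ⟨cokernel.desc _ z (by rw [← hm, Category.assoc, hz]; simp), by simp⟩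

lemma exists_ses' (h : IsTotallyAcyclic 𝒲 X d) {n : ℤ} {M : C} (e : cokernel (d n) ≅ M) :
    ∃ (m : cokernel (d (n + 1)) ⟶ X n) (p : X n ⟶ M), cokernel.π (d (n + 1)) ≫ m = d n ∧
      p = cokernel.π (d n) ≫ e.hom ∧ SES m p := by
  obtain ⟨m, hm, hs⟩ := exists_ses h n
  refine ⟨m, _, hm, rfl, SES.of_lift ?_ hs.mono inferInstance ?_⟩
  · rw [reassoc_of% hs.w]; simp
  · intro Z z hz
    exact hs.lift z (by rw [← cancel_mono e.hom]; simpa using hz)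

lemma cyc_left (h : IsTotallyAcyclic 𝒲 X d) : ∀ S ∈ Cyc X d, ∃ S' ∈ Cyc X d, Syz 𝒲 S' S := by
  rintro S ⟨n, ⟨e⟩⟩
  obtain ⟨m, p, -, -, hs⟩ := exists_ses' h e
  exact ⟨_, ⟨n + 1, ⟨Iso.refl _⟩⟩, X n, m, p, h.mem n, hs⟩

lemma cyc_right (h : IsTotallyAcyclic 𝒲 X d) : ∀ S ∈ Cyc X d, ∃ S' ∈ Cyc X d, Syz 𝒲 S S' := by
  rintro S ⟨n, ⟨e⟩⟩
  obtain ⟨k, rfl⟩ : ∃ k, n = k + 1 := ⟨n - 1, by simp⟩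
  obtain ⟨m, -, hs⟩ := exists_ses h k
  have := hs.mono
  refine ⟨_, ⟨k, ⟨Iso.refl _⟩⟩, X k, e.inv ≫ m, cokernel.π (d k), h.mem k,
    SES.of_desc ?_ inferInstance inferInstance ?_⟩
  · rw [Category.assoc, hs.w]; simp
  · intro Z z hz
    exact hs.desc z (by rw [← cancel_epi e.inv]; simpa using hz)

lemma cyc_perp [HasExt.{w} C] (hperp : ∀ W ∈ 𝒲, ∀ W' ∈ 𝒲, extPerp W W')
    (h : IsTotallyAcyclic 𝒲 X d) : ∀ S ∈ Cyc X d, Perp 𝒲 S := by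
  rintro S ⟨n, ⟨e⟩⟩
  refine Perp.retract e.inv e.hom (by simp) ?_
  intro W hW
  constructor
  · obtain ⟨k, rfl⟩ : ∃ k, n = k + 1 + 1 + 1 := ⟨n - 1 - 1 - 1, by simp⟩
    obtain ⟨m, hm, hs⟩ := exists_ses h (k + 1 + 1)
    obtain ⟨m', hm', hs'⟩ := exists_ses h (k + 1)
    obtain ⟨m'', hm'', hs''⟩ := exists_ses h k
    have := hs'.mono
    refine ext_left_zero hs (hperp W hW _ (h.mem _) 1 le_rfl) fun φ => ?_
    obtain ⟨ψ, hψ⟩ := h.homExact W hW k (φ ≫ m') (by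
      rw [← hm'', Category.assoc, reassoc_of% hs'.w]; simp)
    refine ⟨ψ, ?_⟩
    rw [← cancel_mono m', Category.assoc, hm', hψ]
  · obtain ⟨m, hm, hs⟩ := exists_ses h n
    refine ext_right_zero hs (hperp _ (h.mem _) W hW 1 le_rfl) fun φ => ?_
    obtain ⟨ψ, hψ⟩ := h.homExact' W hW n (cokernel.π _ ≫ φ) (by simp)
    refine ⟨ψ, ?_⟩
    rw [← cancel_epi (cokernel.π (d (n + 1))), reassoc_of% hm, hψ]

end cyc

end GorAux

variable [EnoughProjectives C] [EnoughInjectives C] [HasExt.{w} C]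

/-- Proposition 3.11: if `𝒲 ⊥ 𝒲`, then `G(𝒲)` is closed under direct
summands. -/
theorem stmt_16 (𝒲 : Set C) (h𝒲iso : IsoClosed 𝒲) (h𝒲sum : SumClosed 𝒲)
    (hperp : ∀ W ∈ 𝒲, ∀ W' ∈ 𝒲, extPerp W W')
    (A' A'' : C) (h : (A' ⊞ A'') ∈ GorClass 𝒲) :
    A' ∈ GorClass 𝒲 ∧ A'' ∈ GorClass 𝒲 := by
  have hsw : (A'' ⊞ A') ∈ GorClass 𝒲 := by
    obtain ⟨X, d, hX, ⟨e⟩⟩ := h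
    exact ⟨X, d, hX, ⟨e ≪≫ biprod.braiding A' A''⟩⟩
  have key : ∀ K Y : C, (K ⊞ Y) ∈ GorClass 𝒲 → K ∈ GorClass 𝒲 := by
    rintro K Y ⟨X, d, hX, e⟩
    exact GorAux.summand_gor (𝒢 := GorAux.Cyc X d) h𝒲sum (GorAux.cyc_perp hperp hX)
      (GorAux.cyc_left hX) (GorAux.cyc_right hX) K Y ⟨0, e⟩
  exact ⟨key _ _ h, key _ _ hsw⟩
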